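/- **Architecture.** Let $L\ge 1$. For $0\le l\le L$ the layer-$l$ activation space is $\mathbb{R}^{U_l\times w_l}$ ($U_l$ channels, $w_l$ spatial positions), with $O_l$ convolutional patches $S^{l,1},\dots,S^{l,O_l}$, each an ordered set of $d_{l+1}$ distinct coordinates of $\{1,\dots,U_l\}\times\{1,\dots,w_l\}$. For a filter matrix $A^l\in\mathbb{R}^{m_l\times d_l}$ let $\Lambda_{A^l}(x)_{j,o}=\sum_{i=1}^{d_l}x_{S^{l-1,o}_i}(A^l)_{j,i}$, and let $G_l:\mathbb{R}^{m_l\times O_{l-1}}\to\mathbb{R}^{U_l\times w_l}$ ($1\le l\le L$) be nonlinearities. For $\mathcal{A}=(A^1,\dots,A^L)$ put $F^{l_1\to l_2}=G_{l_2}\circ\Lambda_{A^{l_2}}\circ\cdots\circ G_{l_1+1}\circ\Lambda_{A^{l_1+1}}$ and $F_{\mathcal{A}}=F^{0\to L}$. **Norms.** On layer-$l$ activations, $|x|_l=\max_{o\le O_l}\big(\sum_i x_{S^{l,o}_i}^2\big)^{1/2}$ and $|x|_{\infty,l}=\max_{j\le w_l}\big(\sum_{u\le U_l}x_{u,j}^2\big)^{1/2}$;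 on $\mathbb{R}^{m_l\times O_{l-1}}$, $|z|_*=\max_{o\le O_{l-1}}\big(\sum_{j\le m_l}z_{j,o}^2\big)^{1/2}$. $\|A^\top\|_{2,1}$ is the sum of the Euclidean norms of the rows of $A$. Let $\rho^{\mathcal{A}}_{l_1\to l_2}$ be the Lipschitz constant of $F^{l_1\to l_2}$ from $|\cdot|_{\infty,l_1}$ to $|\cdot|_{l_2}$. **Assumptions.** Each $G_l$ is $1$-Lipschitz from $|\cdot|_*$ to $|\cdot|_{\infty,l}$ (e.g. elementwise ReLU combined with spatial max-pooling). The output layer consists of the scores of $K\ge 2$ classes ($U_L=K$, $w_L=1$), and every output coordinate belongs to at least one of the patches defining $|\cdot|_L$. **Loss class.** Fix $a_1,\dots,a_L>0$, $b_0,\dots,b_{L-1}>0$, $b_L=\gamma>0$ and $\rho_{l_1\to l_2}>0$ for $0\le l_1\le l_2\le L$. With the ramp loss $\lambda_\theta(t)=1+\min(\max(t,-\theta),0)/\theta$, let $$\ell(x,y)=\max\Big[\sup_{1\le l\le L-1}\lambda_{b_l}\big(|F^{0\to l}(x)|_l-2b_l\big),\ \lambda_\gamma\big(\max_{j\ne y}F_{\mathcal{A}}(x)_j-F_{\mathcal{A}}(x)_y\big)\Big]$$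 (the supremum being absent if $L=1$), and let $\mathcal{H}$ be the class of functions $(x,y)\mapsto\ell(x,y)$ obtained as $\mathcal{A}$ ranges over all networks with $\|(A^l)^\top\|_{2,1}\le a_l$ for $1\le l\le L$ and $\rho^{\mathcal{A}}_{l_1\to l_2}\le\rho_{l_1\to l_2}$ for all $0\le l_1\le l_2\le L$. **Claim.** Let $n\ge 1$, let $(x_1,y_1),\dots,(x_n,y_n)$ be any fixed sample with $|x_i|_0\le b_0$ for all $i$, and let $\varepsilon>0$. Let $\mathcal{N}(\mathcal{H},\varepsilon,\|\cdot\|_\infty)$ be the minimum cardinality $N$ of a collection $f^1,\dots,f^N\in\mathcal{H}$ such that every $f\in\mathcal{H}$ has some $f^j$ with $|f(x_i,y_i)-f^j(x_i,y_i)|\le\varepsilon$ for all $i\le n$. It is finite, and (if $\mathcal{H}\neq\emptyset$) $$\log\mathcal{N}(\mathcal{H},\varepsilon,\|\cdot\|_\infty)\le 2^{12}\,\frac{R^2}{\varepsilon^2}\,\log_2\!\Big(\frac{32\,\Gamma n}{\varepsilon}+7\bar W n\Big),$$ where $\rho_{l+}=\max_{l\le i\le L}\rho_{l\to i}/b_i$,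 $R^{2/3}=\sum_{l=1}^L(a_l b_{l-1}\rho_{l+})^{2/3}$, $\Gamma=\max_{1\le l\le L}b_{l-1}a_lO_{l-1}m_l\rho_{l+}$ and $\bar W=\max_{1\le l\le L}O_{l-1}m_l$. (If $\bar W=0$, then $\mathcal{H}$ has at most one element and the right-hand side is read as $0$.) -/

import Mathlib

/-- A convolutional feedforward architecture (only the layers `0, …, L` are used).
`U l`, `w l`: numbers of channels and of spatial positions of the layer-`l` activations.
`O l`: number of convolutional patches of layer `l`.
`m l`, `d l` (for `l ≥ 1`): number of filters and patch size of the convolution from layer `l - 1`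
to layer `l`.
`patch l o`: the `o`-th ordered patch of layer `l`, that is, `d (l + 1)` distinct coordinates.
`G l`: the nonlinearity (activation and pooling) that produces the layer-`(l + 1)` activations. -/
structure ConvNet where
  U : ℕ → ℕ
  w : ℕ → ℕ
  m : ℕ → ℕ
  d : ℕ → ℕ
  O : ℕ → ℕ
  patch : (l : ℕ) → Fin (O l) → (Fin (d (l + 1)) ↪ Fin (U l) × Fin (w l))
  G : (l : ℕ) → Matrix (Fin (m (l + 1))) (Fin (O l)) ℝ →
    Matrix (Fin (U (l + 1))) (Fin (w (l + 1))) ℝ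

namespace ConvNet

variable (net : ConvNet)

/-- The layer-`l` activation space `ℝ^{U_l × w_l}`. -/
abbrev Act (l : ℕ) := Matrix (Fin (net.U l)) (Fin (net.w l)) ℝ

/-- The space `ℝ^{m_{l+1} × O_l}` of preactivations of layer `l + 1`. -/
abbrev PreAct (l : ℕ) := Matrix (Fin (net.m (l + 1))) (Fin (net.O l)) ℝ

/-- Filter matrices of the convolution from layer `l` to layer `l + 1`; rows are filters. -/
abbrev Wt (l : ℕ) := Matrix (Fin (net.m (l + 1))) (Fin (net.d (l + 1))) ℝ

/-- The convolution `Λ_A`. -/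
def conv (l : ℕ) (A : net.Wt l) (x : net.Act l) : net.PreAct l :=
  fun j o => ∑ i, x (net.patch l o i).1 (net.patch l o i).2 * A j i

/-- One layer: convolution followed by the nonlinearity. -/
def layer (l : ℕ) (A : net.Wt l) (x : net.Act l) : net.Act (l + 1) :=
  net.G l (net.conv l A x)

/-- The network `F^{0→l}`; here `A l` is the filter matrix of layer `l + 1`. -/
def F (A : ∀ l, net.Wt l) : (l : ℕ) → net.Act 0 → net.Act l
  | 0 => id
  | l + 1 => fun x => net.layer l (A l) (F A l x)

/-- The subnetwork `F^{l₁→l₁+k}`. -/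
def sub (A : ∀ l, net.Wt l) (l₁ : ℕ) : (k : ℕ) → net.Act l₁ → net.Act (l₁ + k)
  | 0 => id
  | k + 1 => fun x => net.layer (l₁ + k) (A (l₁ + k)) (sub A l₁ k x)

/-- `|x|_l`: the maximum Euclidean norm of a convolutional patch of `x`. -/
noncomputable def patchNorm (l : ℕ) (x : net.Act l) : ℝ :=
  ⨆ o : Fin (net.O l), √(∑ i, (x (net.patch l o i).1 (net.patch l o i).2) ^ 2)

/-- `|x|_{∞,l}`: the maximum over spatial positions of the Euclidean norm across channels. -/
noncomputable def pixelNorm (l : ℕ) (x : net.Act l) : ℝ :=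
  ⨆ j : Fin (net.w l), √(∑ u, (x u j) ^ 2)

/-- The analogue of `|·|_{∞,l}` on preactivations: the maximum over patches of the Euclidean norm
across filters. -/
noncomputable def preNorm (l : ℕ) (z : net.PreAct l) : ℝ :=
  ⨆ o : Fin (net.O l), √(∑ j, (z j o) ^ 2)

/-- `‖A^⊤‖_{2,1}`: the sum of the Euclidean norms of the rows of `A`. -/
noncomputable def norm21 (l : ℕ) (A : net.Wt l) : ℝ :=
  ∑ j, √(∑ i, (A j i) ^ 2)

/-- `ρ^𝒜_{l₁→l₁+k} ≤ c`: the subnetwork `F^{l₁→l₁+k}` is `c`-Lipschitz with respect to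
`|·|_{∞,l₁}` and `|·|_{l₁+k}`. -/
def SubLipschitz (A : ∀ l, net.Wt l) (l₁ k : ℕ) (c : ℝ) : Prop :=
  ∀ x y : net.Act l₁,
    net.patchNorm (l₁ + k) (net.sub A l₁ k x - net.sub A l₁ k y) ≤ c * net.pixelNorm l₁ (x - y)

/-- The networks with `‖(A^l)^⊤‖_{2,1} ≤ a_l` for `1 ≤ l ≤ L` and
`ρ^𝒜_{l₁→l₂} ≤ ρ_{l₁→l₂}` for `l₁ ≤ l₂ ≤ L`. -/
def Admissible (L : ℕ) (a : ℕ → ℝ) (ρ : ℕ → ℕ → ℝ) (A : ∀ l, net.Wt l) : Prop :=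
  (∀ l, l < L → net.norm21 l (A l) ≤ a (l + 1)) ∧
    ∀ l₁ k, l₁ + k ≤ L → net.SubLipschitz A l₁ k (ρ l₁ (l₁ + k))

/-- The class score `F_𝒜(x)_c`; the last layer has a single spatial position. -/
def score (L : ℕ) (hw : net.w L = 1) (A : ∀ l, net.Wt l) (x : net.Act 0)
    (c : Fin (net.U L)) : ℝ :=
  net.F A L x c ⟨0, by omega⟩

end ConvNet

/-- The ramp loss `λ_θ(t) = 1 + min(max(t, −θ), 0)/θ`. -/
noncomputable def ramp (θ t : ℝ) : ℝ := 1 + min (max t (-θ)) 0 / θ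

namespace ConvNet

variable (net : ConvNet)

/-- The loss `max[sup_{l=1}^{L-1} λ_{b_l}(|F^{0→l}(x)|_l − 2b_l), λ_{b_L}(max_{j≠y} F(x)_j − F(x)_y)]`.
For `L = 1` the empty supremum is `0`, the least value of the ramp loss. -/
noncomputable def loss (L : ℕ) (hw : net.w L = 1) (b : ℕ → ℝ) (A : ∀ l, net.Wt l)
    (x : net.Act 0) (y : Fin (net.U L)) : ℝ :=
  max
    (⨆ l : Set.Ico 1 L, ramp (b l) (net.patchNorm l (net.F A l x) - 2 * b l))
    (ramp (b L) ((⨆ j : {j : Fin (net.U L) // j ≠ y}, net.score L hw A x j) -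
      net.score L hw A x y))

/-- The loss class restricted to a sample, as a subset of `ℝⁿ` (with the sup metric). -/
def lossClass (L : ℕ) (hw : net.w L = 1) (a b : ℕ → ℝ) (ρ : ℕ → ℕ → ℝ) {n : ℕ}
    (s : Fin n → net.Act 0 × Fin (net.U L)) : Set (Fin n → ℝ) :=
  {v | ∃ A : ∀ l, net.Wt l, net.Admissible L a ρ A ∧
    v = fun i => net.loss L hw b A (s i).1 (s i).2}

/-- `W̄ = max_{l=1}^L O_{l-1} m_l`. -/
noncomputable def maxWidth (L : ℕ) : ℝ :=
  ⨆ l : Fin L, (net.O l : ℝ) * net.m (l + 1)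

end ConvNet

/-- `ρ_{l+} = max_{i=l}^{L} ρ_{l→i}/b_i`. -/
noncomputable def rhoPlus (L : ℕ) (ρ : ℕ → ℕ → ℝ) (b : ℕ → ℝ) (l : ℕ) : ℝ :=
  ⨆ i : Set.Icc l L, ρ l i / b i

/-- `R`, where `R^{2/3} = ∑_{l=1}^L (a_l b_{l-1} ρ_{l+})^{2/3}`. -/
noncomputable def complexityR (L : ℕ) (a b : ℕ → ℝ) (ρ : ℕ → ℕ → ℝ) : ℝ :=
  (∑ l ∈ Finset.range L,
    (a (l + 1) * b l * rhoPlus L ρ b (l + 1)) ^ ((2 : ℝ) / 3)) ^ ((3 : ℝ) / 2)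

/-- `Γ = max_{l=1}^L b_{l-1} a_l O_{l-1} m_l ρ_{l+}`. -/
noncomputable def ConvNet.Gam (net : ConvNet) (L : ℕ) (a b : ℕ → ℝ) (ρ : ℕ → ℕ → ℝ) : ℝ :=
  ⨆ l : Fin L, b l * a (l + 1) * net.O l * net.m (l + 1) * rhoPlus L ρ b (l + 1)

section SparseCover

open scoped InnerProductSpace

variable {E : Type*} [NormedAddCommGroup E] [InnerProductSpace ℝ E]

/-- The correction `± (δ / b²) X i` made by the perceptron. -/
noncomputable def perceptronStep {ι : Type*} (X : ι → E) (b δ : ℝ) (p : ι × Bool) : E :=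
  (if p.2 then δ / b ^ 2 else -(δ / b ^ 2)) • X p.1

/-- The mistake bound of the perceptron: every vector `w` agrees up to `δ`, on all the points `X i`,
with a sum of at most `‖w‖² b² / δ²` corrections. -/
theorem exists_perceptron_list {ι : Type*} (X : ι → E) {b δ : ℝ} (hb : 0 < b) (hδ : 0 < δ)
    (hX : ∀ i, ‖X i‖ ≤ b) (k : ℕ) (w : E) (hw : ‖w‖ ^ 2 * b ^ 2 / δ ^ 2 < k + 1) :
    ∃ t : List (ι × Bool), t.length ≤ k ∧
      ∀ i, |⟪w - (t.map (perceptronStep X b δ)).sum, X i⟫_ℝ| ≤ δ := by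
  induction k generalizing w with
  | zero =>
    refine ⟨[], le_rfl, fun i => ?_⟩
    have h1 : |⟪w, X i⟫_ℝ| ≤ ‖w‖ * b :=
      (abs_real_inner_le_norm w (X i)).trans (mul_le_mul_of_nonneg_left (hX i) (norm_nonneg w))
    have h2 : (‖w‖ * b) ^ 2 ≤ δ ^ 2 := by
      rw [div_lt_iff₀ (by positivity)] at hw
      rw [mul_pow]
      simp only [Nat.cast_zero, zero_add, one_mul] at hw
      exact hw.le
    have h3 := (sq_le_sq₀ (by positivity) hδ.le).1 h2
    simpa using h1.trans h3
  | succ k ih =>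
    by_cases hgood : ∀ i, |⟪w, X i⟫_ℝ| ≤ δ
    · exact ⟨[], Nat.zero_le _, by simpa using hgood⟩
    · push Not at hgood
      obtain ⟨i, hi⟩ := hgood
      obtain ⟨s, hs⟩ : ∃ s : Bool, ⟪w, perceptronStep X b δ (i, s)⟫_ℝ =
          δ / b ^ 2 * |⟪w, X i⟫_ℝ| := by
        rcases le_total 0 ⟪w, X i⟫_ℝ with h | h
        · exact ⟨true, by simp [perceptronStep, inner_smul_right, abs_of_nonneg h]⟩
        · exact ⟨false, by simp [perceptronStep, inner_smul_right, abs_of_nonpos h]⟩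
      have hn : ‖perceptronStep X b δ (i, s)‖ ≤ δ / b := by
        have : ‖perceptronStep X b δ (i, s)‖ = δ / b ^ 2 * ‖X i‖ := by
          have h0 : 0 < δ / b ^ 2 := by positivity
          cases s <;> simp [perceptronStep, norm_smul, abs_of_pos hδ]
        rw [this]
        calc δ / b ^ 2 * ‖X i‖ ≤ δ / b ^ 2 * b :=
              mul_le_mul_of_nonneg_left (hX i) (by positivity)
          _ = δ / b := by field_simp
      have hdec : ‖w - perceptronStep X b δ (i, s)‖ ^ 2 ≤ ‖w‖ ^ 2 - δ ^ 2 / b ^ 2 := by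
        rw [norm_sub_sq_real, hs]
        have h1 : ‖perceptronStep X b δ (i, s)‖ ^ 2 ≤ (δ / b) ^ 2 :=
          pow_le_pow_left₀ (norm_nonneg _) hn 2
        have h2 : δ / b ^ 2 * δ ≤ δ / b ^ 2 * |⟪w, X i⟫_ℝ| :=
          mul_le_mul_of_nonneg_left hi.le (by positivity)
        have h3 : δ / b ^ 2 * δ = δ ^ 2 / b ^ 2 := by ring
        rw [div_pow] at h1
        linarith
      obtain ⟨t, ht, hgood⟩ := ih (w - perceptronStep X b δ (i, s)) (by
        rw [div_lt_iff₀ (by positivity)] at hw ⊢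
        have h1 := mul_le_mul_of_nonneg_right hdec (sq_nonneg b)
        have h2 : (‖w‖ ^ 2 - δ ^ 2 / b ^ 2) * b ^ 2 = ‖w‖ ^ 2 * b ^ 2 - δ ^ 2 := by
          field_simp
        push_cast at hw
        linarith)
      refine ⟨(i, s) :: t, by simpa using ht, fun i' => ?_⟩
      have := hgood i'
      rwa [sub_sub] at this

variable {κ ι : Type*} [Fintype κ] [Fintype ι]

open Classical in
/-- The states `(A, q)` that one letter leads to: `q` is incremented, or one row of `A`
is corrected at the scale `ε / q`, or nothing happens. -/
noncomputable def nextStates (X : ι → E) (b ε : ℝ) (s : (κ → E) × ℕ) : Finset ((κ → E) × ℕ) :=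
  insert s (insert (s.1, s.2 + 1) (Finset.univ.image fun p : κ × (ι × Bool) =>
    (s.1 + Pi.single p.1 (perceptronStep X b (ε / s.2) p.2), s.2)))

open Classical in
/-- The states reachable from `(0, 0)` by words of length `k`. -/
noncomputable def reachable (κ : Type*) [Fintype κ] (X : ι → E) (b ε : ℝ) :
    ℕ → Finset ((κ → E) × ℕ)
  | 0 => {(0, 0)}
  | k + 1 => (reachable κ X b ε k).biUnion (nextStates X b ε)

theorem card_reachable_le (X : ι → E) (b ε : ℝ) (k : ℕ) :
    (reachable κ X b ε k).card ≤ (2 * (Fintype.card κ * Fintype.card ι) + 2) ^ k := by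
  classical
  induction k with
  | zero => simp [reachable]
  | succ k ih =>
    rw [pow_succ]
    refine (Finset.card_biUnion_le_card_mul _ _
      (2 * (Fintype.card κ * Fintype.card ι) + 2) fun s _ => ?_).trans
      (Nat.mul_le_mul_right _ ih)
    refine (Finset.card_insert_le _ _).trans (Nat.succ_le_succ
      ((Finset.card_insert_le _ _).trans (Nat.succ_le_succ ?_)))
    refine Finset.card_image_le.trans ?_
    simp only [Finset.card_univ, Fintype.card_prod, Fintype.card_bool]
    exact le_of_eq (by ring)

variable {X : ι → E} {b ε : ℝ}

theorem reachable_mono {k k' : ℕ} (h : k ≤ k') : reachable κ X b ε k ⊆ reachable κ X b ε k' := by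
  classical
  induction k', h using Nat.le_induction with
  | base => exact subset_rfl
  | succ k' _ ih =>
    intro s hs
    exact Finset.mem_biUnion.2 ⟨s, ih hs, by simp [nextStates]⟩

theorem reachable_incr {k q : ℕ} {A : κ → E} (h : (A, q) ∈ reachable κ X b ε k) :
    (A, q + 1) ∈ reachable κ X b ε (k + 1) := by
  classical
  exact Finset.mem_biUnion.2 ⟨_, h, by simp [nextStates]⟩

theorem reachable_row [DecidableEq κ] {k q : ℕ} {A : κ → E}
    (h : (A, q) ∈ reachable κ X b ε k) (j : κ) (t : List (ι × Bool)) :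
    (A + Pi.single j (t.map (perceptronStep X b (ε / q))).sum, q) ∈
      reachable κ X b ε (k + t.length) := by
  induction t generalizing k A with
  | nil => simpa using h
  | cons p t ih =>
    have h1 : (A + Pi.single j (perceptronStep X b (ε / q) p), q) ∈ reachable κ X b ε (k + 1) := by
      classical
      refine Finset.mem_biUnion.2 ⟨_, h, ?_⟩
      simp only [nextStates, Finset.mem_insert, Finset.mem_image, Finset.mem_univ, true_and]
      refine Or.inr (Or.inr ⟨(j, p), ?_⟩)
      congr!
    have h2 := ih h1
    rw [List.map_cons, List.sum_cons, Pi.single_add, ← add_assoc, List.length_cons,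
      show k + (t.length + 1) = k + 1 + t.length by ring]
    exact h2

theorem reachable_rows [DecidableEq κ] {k q : ℕ} {A : κ → E}
    (h : (A, q) ∈ reachable κ X b ε k) (P : Finset κ) (t : κ → List (ι × Bool)) (v : κ → E)
    (hv : ∀ j ∈ P, v j = ((t j).map (perceptronStep X b (ε / q))).sum) :
    (A + ∑ j ∈ P, Pi.single j (v j), q) ∈
      reachable κ X b ε (k + ∑ j ∈ P, (t j).length) := by
  induction P using Finset.induction_on with
  | empty => simpa using h
  | insert j P hj ih =>
    have h1 := reachable_row (ih fun i hi => hv i (Finset.mem_insert_of_mem hi)) j (t j)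
    rw [← hv j (Finset.mem_insert_self j P)] at h1
    rw [Finset.sum_insert hj, Finset.sum_insert hj]
    convert h1 using 2
    · ring
    · abel

/-- Rows may be corrected at different scales, in the order of the scales. -/
theorem reachable_scales [DecidableEq κ] (P : Finset κ) (q : κ → ℕ) (t : κ → List (ι × Bool))
    (v : κ → E) (hv : ∀ j ∈ P, v j = ((t j).map (perceptronStep X b (ε / q j))).sum) (T : ℕ) :
    (∑ j ∈ P with q j ≤ T, Pi.single j (v j), T) ∈
      reachable κ X b ε (T + ∑ j ∈ P with q j ≤ T, (t j).length) := by
  induction T with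
  | zero =>
    have h0 : ((0 : κ → E), 0) ∈ reachable κ X b ε 0 := by simp [reachable]
    have := reachable_rows h0 (P.filter fun j => q j ≤ 0) t v fun j hj => by
      rw [Finset.mem_filter] at hj
      rw [hv j hj.1, Nat.le_zero.1 hj.2]
    convert this using 2
    rw [zero_add]
  | succ T ih =>
    have := reachable_rows (reachable_incr ih) (P.filter fun j => q j = T + 1) t v fun j hj => by
      rw [Finset.mem_filter] at hj
      rw [hv j hj.1, hj.2]
    have hsplit : P.filter (fun j => q j ≤ T + 1) =
        P.filter (fun j => q j ≤ T) ∪ P.filter (fun j => q j = T + 1) := by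
      ext j
      simp only [Finset.mem_filter, Finset.mem_union, Nat.le_succ_iff]
      tauto
    have hdisj : Disjoint (P.filter fun j => q j ≤ T) (P.filter fun j => q j = T + 1) :=
      Finset.disjoint_filter.2 fun j _ h1 h2 => by omega
    rw [hsplit, Finset.sum_union hdisj, Finset.sum_union hdisj]
    convert this using 2
    ring

/-- Covering of the linear maps whose rows have norms with sum at most `a`. -/
theorem exists_sparse_cover (X : ι → E) {a b ε : ℝ} (ha : 0 < a) (hb : 0 < b) (hε : 0 < ε)
    (hX : ∀ i, ‖X i‖ ≤ b) :
    ∃ C : Finset (κ → E),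
      C.card ≤ max 1 (4 * (Fintype.card κ * Fintype.card ι)) ^ ⌊6 * (a * b / ε) ^ 2⌋₊ ∧
      ∀ A : κ → E, ∑ j, ‖A j‖ ≤ a →
        ∃ A' ∈ C, ∀ i, ∑ j, ⟪A j - A' j, X i⟫_ℝ ^ 2 ≤ ε ^ 2 := by
  classical
  rcases Nat.eq_zero_or_pos (Fintype.card κ * Fintype.card ι) with h0 | hpos
  · refine ⟨{0}, by simp [h0], fun A _ => ⟨0, by simp, fun i => ?_⟩⟩
    rcases Nat.mul_eq_zero.1 h0 with h | h
    · have := Fintype.card_eq_zero_iff.1 h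
      simp only [Finset.univ_eq_empty, Finset.sum_empty]
      positivity
    · exact ((Fintype.card_eq_zero_iff.1 h).false i).elim
  set K := ⌊6 * (a * b / ε) ^ 2⌋₊ with hK
  refine ⟨(reachable κ X b ε K).image Prod.fst, ?_, fun A hA => ?_⟩
  · refine Finset.card_image_le.trans ((card_reachable_le X b ε K).trans
      (Nat.pow_le_pow_left (le_max_of_le_right ?_) _))
    omega
  set Q := a * b / ε with hQ
  have hQ0 : 0 < Q := by positivity
  have hAj : ∀ j, ‖A j‖ ≤ a := fun j =>
    (Finset.single_le_sum (f := fun j => ‖A j‖) (fun _ _ => norm_nonneg _)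
      (Finset.mem_univ j)).trans hA
  suffices h : ∃ A' : κ → E, (∃ T, (A', T) ∈ reachable κ X b ε K) ∧
      ∀ i j, ⟪A j - A' j, X i⟫_ℝ ^ 2 ≤ ε ^ 2 * (‖A j‖ / a) by
    obtain ⟨A', ⟨T, hT⟩, h⟩ := h
    refine ⟨A', Finset.mem_image.2 ⟨_, hT, rfl⟩, fun i => ?_⟩
    calc ∑ j, ⟪A j - A' j, X i⟫_ℝ ^ 2 ≤ ∑ j, ε ^ 2 * (‖A j‖ / a) :=
          Finset.sum_le_sum fun j _ => h i j
      _ = ε ^ 2 * ((∑ j, ‖A j‖) / a) := by rw [← Finset.mul_sum, Finset.sum_div]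
      _ ≤ ε ^ 2 * 1 := by
          gcongr
          exact (div_le_one ha).2 hA
      _ = ε ^ 2 := mul_one _
  have hinner : ∀ (w : E) i, |⟪w, X i⟫_ℝ| ≤ ‖w‖ * b := fun w i =>
    (abs_real_inner_le_norm w (X i)).trans (mul_le_mul_of_nonneg_left (hX i) (norm_nonneg w))
  -- Rows of small norm are replaced by zero.
  have hlight : ∀ j, ‖A j‖ * Q ^ 2 ≤ a → ∀ i, ⟪A j, X i⟫_ℝ ^ 2 ≤ ε ^ 2 * (‖A j‖ / a) := by
    intro j hj i
    rw [← sq_abs]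
    calc |⟪A j, X i⟫_ℝ| ^ 2 ≤ (‖A j‖ * b) ^ 2 := pow_le_pow_left₀ (abs_nonneg _) (hinner _ _) 2
      _ = ‖A j‖ * (ε ^ 2 / a ^ 2) * (‖A j‖ * Q ^ 2) := by rw [hQ]; field_simp
      _ ≤ ‖A j‖ * (ε ^ 2 / a ^ 2) * a := by gcongr
      _ = ε ^ 2 * (‖A j‖ / a) := by field_simp
  set H : Finset κ := Finset.univ.filter fun j => a < ‖A j‖ * Q ^ 2 with hH
  rcases H.eq_empty_or_nonempty with hemp | ⟨j₀, hj₀⟩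
  · refine ⟨0, ⟨0, reachable_mono (Nat.zero_le K) (by simp [reachable])⟩, fun i j => ?_⟩
    have : j ∉ H := by simp [hemp]
    simpa using hlight j (by simpa [hH] using this) i
  have hQ1 : 1 ≤ Q := by
    have h1 : a < ‖A j₀‖ * Q ^ 2 := by simpa [hH] using hj₀
    have h2 : ‖A j₀‖ * Q ^ 2 ≤ a * Q ^ 2 := mul_le_mul_of_nonneg_right (hAj j₀) (sq_nonneg Q)
    by_contra hlt
    push Not at hlt
    have h3 : a * Q ^ 2 ≤ a * 1 :=
      mul_le_mul_of_nonneg_left (pow_le_one₀ hQ0.le hlt.le) ha.le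
    linarith
  have hApos : ∀ j ∈ H, 0 < ‖A j‖ := by
    intro j hj
    have h1 : a < ‖A j‖ * Q ^ 2 := by simpa [hH] using hj
    by_contra h
    have : ‖A j‖ = 0 := le_antisymm (not_lt.1 h) (norm_nonneg _)
    rw [this, zero_mul] at h1
    exact absurd h1 (not_lt.2 ha.le)
  set q : κ → ℕ := fun j => ⌈√(a / ‖A j‖)⌉₊ with hq
  have hsq : ∀ j ∈ H, √(a / ‖A j‖) ^ 2 = a / ‖A j‖ := fun j hj =>
    Real.sq_sqrt (div_nonneg ha.le (norm_nonneg _))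
  have hsq1 : ∀ j ∈ H, 1 ≤ √(a / ‖A j‖) := fun j hj => by
    rw [Real.one_le_sqrt, one_le_div (hApos j hj)]
    exact hAj j
  have hq1 : ∀ j ∈ H, √(a / ‖A j‖) ≤ q j := fun j _ => Nat.le_ceil _
  have hq2 : ∀ j ∈ H, (q j : ℝ) ≤ 2 * √(a / ‖A j‖) := fun j hj => by
    have := (Nat.ceil_lt_add_one (Real.sqrt_nonneg (a / ‖A j‖))).le
    linarith [hsq1 j hj]
  have hqpos : ∀ j ∈ H, (0 : ℝ) < q j := fun j hj =>
    lt_of_lt_of_le one_pos ((hsq1 j hj).trans (hq1 j hj))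
  have hqT : ∀ j ∈ H, q j ≤ ⌈Q⌉₊ := fun j hj => by
    refine Nat.ceil_mono ?_
    rw [Real.sqrt_le_left hQ0.le, div_le_iff₀ (hApos j hj)]
    have h1 : a < ‖A j‖ * Q ^ 2 := by simpa [hH] using hj
    linarith
  have hrow : ∀ j, ∃ t : List (ι × Bool), j ∈ H →
      t.length ≤ ⌊‖A j‖ ^ 2 * b ^ 2 / (ε / q j) ^ 2⌋₊ ∧
      ∀ i, |⟪A j - (t.map (perceptronStep X b (ε / q j))).sum, X i⟫_ℝ| ≤ ε / q j := by
    intro j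
    by_cases hj : j ∈ H
    · obtain ⟨t, ht⟩ := exists_perceptron_list X hb (div_pos hε (hqpos j hj)) hX _ (A j)
        (Nat.lt_floor_add_one (‖A j‖ ^ 2 * b ^ 2 / (ε / q j) ^ 2))
      exact ⟨t, fun _ => ht⟩
    · exact ⟨[], fun h => absurd h hj⟩
  choose t ht using hrow
  set v : κ → E := fun j => ((t j).map (perceptronStep X b (ε / q j))).sum with hv
  have hlen : ∀ j ∈ H, ((t j).length : ℝ) ≤ 4 * Q ^ 2 * (‖A j‖ / a) := by
    intro j hj
    have h1 : ((t j).length : ℝ) ≤ ‖A j‖ ^ 2 * b ^ 2 / (ε / q j) ^ 2 :=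
      (Nat.cast_le.2 (ht j hj).1).trans (Nat.floor_le (by positivity))
    have h2 : (q j : ℝ) ^ 2 ≤ 4 * (a / ‖A j‖) := by
      rw [← hsq j hj]
      calc (q j : ℝ) ^ 2 ≤ (2 * √(a / ‖A j‖)) ^ 2 := pow_le_pow_left₀ (hqpos j hj).le (hq2 j hj) 2
        _ = _ := by ring
    have h3 := hApos j hj
    have h4 := hqpos j hj
    calc ((t j).length : ℝ) ≤ ‖A j‖ ^ 2 * b ^ 2 / (ε / q j) ^ 2 := h1
      _ = ‖A j‖ ^ 2 * b ^ 2 / ε ^ 2 * (q j : ℝ) ^ 2 := by field_simp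
      _ ≤ ‖A j‖ ^ 2 * b ^ 2 / ε ^ 2 * (4 * (a / ‖A j‖)) := by gcongr
      _ = 4 * Q ^ 2 * (‖A j‖ / a) := by rw [hQ]; field_simp
  have hreach := reachable_scales (X := X) (b := b) (ε := ε) H q t v (fun j _ => rfl) ⌈Q⌉₊
  have hfilter : (H.filter fun j => q j ≤ ⌈Q⌉₊) = H :=
    Finset.filter_true_of_mem hqT
  rw [hfilter] at hreach
  refine ⟨∑ j ∈ H, Pi.single j (v j), ⟨⌈Q⌉₊, reachable_mono ?_ hreach⟩, fun i j => ?_⟩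
  · rw [hK]
    refine Nat.le_floor ?_
    push_cast
    have h1 : ∑ j ∈ H, ((t j).length : ℝ) ≤ 4 * Q ^ 2 := by
      calc ∑ j ∈ H, ((t j).length : ℝ) ≤ ∑ j ∈ H, 4 * Q ^ 2 * (‖A j‖ / a) :=
            Finset.sum_le_sum hlen
        _ ≤ ∑ j, 4 * Q ^ 2 * (‖A j‖ / a) :=
            Finset.sum_le_sum_of_subset_of_nonneg (Finset.subset_univ H)
              fun j _ _ => by positivity
        _ = 4 * Q ^ 2 * ((∑ j, ‖A j‖) / a) := by rw [← Finset.mul_sum, Finset.sum_div]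
        _ ≤ 4 * Q ^ 2 * 1 := by
            gcongr
            exact (div_le_one ha).2 hA
        _ = 4 * Q ^ 2 := mul_one _
    have h2 := (Nat.ceil_lt_add_one hQ0.le).le
    nlinarith
  · have hval : (∑ j ∈ H, Pi.single j (v j) : κ → E) j = if j ∈ H then v j else 0 := by
      rw [Finset.sum_apply]
      simp [Pi.single_apply, Finset.sum_ite_eq]
    rw [hval]
    split_ifs with hj
    · rw [← sq_abs]
      have h3 := hApos j hj
      have h4 := hqpos j hj
      calc |⟪A j - v j, X i⟫_ℝ| ^ 2 ≤ (ε / q j) ^ 2 :=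
            pow_le_pow_left₀ (abs_nonneg _) ((ht j hj).2 i) 2
        _ = ε ^ 2 / (q j : ℝ) ^ 2 := div_pow _ _ _
        _ ≤ ε ^ 2 / (√(a / ‖A j‖) ^ 2) := by
            have := hsq1 j hj
            gcongr
            exact hq1 j hj
        _ = ε ^ 2 * (‖A j‖ / a) := by
            rw [hsq j hj]
            field_simp
    · rw [sub_zero]
      exact hlight j (by simpa [hH] using hj) i

end SparseCover

theorem abs_iSup_sub_iSup_le {ι : Type*} [Finite ι] {f g : ι → ℝ} {c : ℝ} (hc : 0 ≤ c)
    (h : ∀ i, |f i - g i| ≤ c) : |(⨆ i, f i) - ⨆ i, g i| ≤ c := by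
  rcases isEmpty_or_nonempty ι with _ | _
  · simpa using hc
  · rw [abs_sub_le_iff, sub_le_iff_le_add, sub_le_iff_le_add]
    constructor
    · refine ciSup_le fun i => ?_
      linarith [(abs_sub_le_iff.1 (h i)).1, le_ciSup (Finite.bddAbove_range g) i]
    · refine ciSup_le fun i => ?_
      linarith [(abs_sub_le_iff.1 (h i)).2, le_ciSup (Finite.bddAbove_range f) i]

theorem ramp_nonneg {θ : ℝ} (hθ : 0 < θ) (t : ℝ) : 0 ≤ ramp θ t := by
  have h : -θ ≤ min (max t (-θ)) 0 := le_min (le_max_right _ _) (by linarith)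
  have := (le_div_iff₀ hθ).2 (by linarith : -1 * θ ≤ min (max t (-θ)) 0)
  unfold ramp
  linarith

theorem ramp_le_one {θ : ℝ} (hθ : 0 < θ) (t : ℝ) : ramp θ t ≤ 1 := by
  have := div_nonpos_of_nonpos_of_nonneg (min_le_right (max t (-θ)) 0) hθ.le
  unfold ramp
  linarith

theorem ramp_of_nonneg {θ t : ℝ} (ht : 0 ≤ t) : ramp θ t = 1 := by
  simp [ramp, min_eq_right (le_max_of_le_left ht : 0 ≤ max t (-θ))]

theorem abs_ramp_sub_le {θ c t t' : ℝ} (hθ : 0 < θ) (h : |t - t'| ≤ c * θ) :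
    |ramp θ t - ramp θ t'| ≤ c := by
  have h1 : ramp θ t - ramp θ t' = (min (max t (-θ)) 0 - min (max t' (-θ)) 0) / θ := by
    unfold ramp
    ring
  rw [h1, abs_div, abs_of_pos hθ, div_le_iff₀ hθ]
  refine ((abs_min_sub_min_le_max _ _ _ _).trans ?_).trans h
  refine max_le ((abs_max_sub_max_le_max _ _ _ _).trans ?_) (by simp)
  simp

namespace ConvNet

variable (net : ConvNet)

open scoped InnerProductSpace

/-- The `o`-th patch of `x` as a Euclidean vector. -/
noncomputable def patchVec (l : ℕ) (x : net.Act l) (o : Fin (net.O l)) :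
    EuclideanSpace ℝ (Fin (net.d (l + 1))) :=
  WithLp.toLp 2 fun i => x (net.patch l o i).1 (net.patch l o i).2

theorem patchVec_sub (l : ℕ) (x y : net.Act l) (o : Fin (net.O l)) :
    net.patchVec l (x - y) o = net.patchVec l x o - net.patchVec l y o := rfl

theorem patchNorm_eq (l : ℕ) (x : net.Act l) : net.patchNorm l x = ⨆ o, ‖net.patchVec l x o‖ := by
  simp [patchNorm, patchVec, EuclideanSpace.norm_eq]

theorem norm_patchVec_le (l : ℕ) (x : net.Act l) (o : Fin (net.O l)) :
    ‖net.patchVec l x o‖ ≤ net.patchNorm l x := by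
  rw [patchNorm_eq]
  exact le_ciSup (Finite.bddAbove_range fun o => ‖net.patchVec l x o‖) o

theorem patchNorm_nonneg (l : ℕ) (x : net.Act l) : 0 ≤ net.patchNorm l x := by
  rw [patchNorm_eq]
  exact Real.iSup_nonneg fun _ => norm_nonneg _

theorem patchNorm_le {l : ℕ} {x : net.Act l} {c : ℝ} (hc : 0 ≤ c)
    (h : ∀ o, ‖net.patchVec l x o‖ ≤ c) : net.patchNorm l x ≤ c := by
  rw [patchNorm_eq]
  exact Real.iSup_le h hc

theorem patchNorm_sub_le (l : ℕ) (x y z : net.Act l) :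
    net.patchNorm l (x - z) ≤ net.patchNorm l (x - y) + net.patchNorm l (y - z) := by
  refine net.patchNorm_le (add_nonneg (net.patchNorm_nonneg _ _) (net.patchNorm_nonneg _ _))
    fun o => ?_
  refine le_trans ?_ (add_le_add (net.norm_patchVec_le l (x - y) o)
    (net.norm_patchVec_le l (y - z) o))
  simp only [patchVec_sub]
  exact norm_sub_le_norm_sub_add_norm_sub _ _ _

theorem abs_patchNorm_sub_patchNorm_le (l : ℕ) (x y : net.Act l) :
    |net.patchNorm l x - net.patchNorm l y| ≤ net.patchNorm l (x - y) := by
  rw [patchNorm_eq, patchNorm_eq net l y]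
  refine abs_iSup_sub_iSup_le (net.patchNorm_nonneg _ _) fun o => ?_
  exact (abs_norm_sub_norm_le _ _).trans (net.norm_patchVec_le l (x - y) o)

theorem abs_apply_le_patchNorm {l : ℕ} (x : net.Act l) (p : Fin (net.U l) × Fin (net.w l))
    (hp : ∃ o i, net.patch l o i = p) : |x p.1 p.2| ≤ net.patchNorm l x := by
  obtain ⟨o, i, rfl⟩ := hp
  refine le_trans ?_ (net.norm_patchVec_le l x o)
  exact PiLp.norm_apply_le (net.patchVec l x o) i

/-- `y` is obtained from the layer-`l₁` activations `x` by the layers `l₁ + 1, …, l₂`. -/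
inductive Runs (A : ∀ l, net.Wt l) (l₁ : ℕ) (x : net.Act l₁) : (l₂ : ℕ) → net.Act l₂ → Prop
  | refl : Runs A l₁ x l₁ x
  | step {l₂ : ℕ} {y : net.Act l₂} : Runs A l₁ x l₂ y → Runs A l₁ x (l₂ + 1) (net.layer l₂ (A l₂) y)

variable {net}

theorem Runs.head {A : ∀ l, net.Wt l} {l₁ l₂ : ℕ} {x : net.Act l₁} {y : net.Act l₂}
    (h : net.Runs A (l₁ + 1) (net.layer l₁ (A l₁) x) l₂ y) : net.Runs A l₁ x l₂ y := by
  induction h with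
  | refl => exact .step .refl
  | step _ ih => exact .step ih

theorem Runs.exists_sub {A : ∀ l, net.Wt l} {l₁ l₂ : ℕ} {x : net.Act l₁} {y : net.Act l₂}
    (h : net.Runs A l₁ x l₂ y) : ∃ k, l₂ = l₁ + k ∧ y ≍ net.sub A l₁ k x := by
  induction h with
  | refl => exact ⟨0, rfl, HEq.rfl⟩
  | step _ ih =>
    obtain ⟨k, rfl, h⟩ := ih
    exact ⟨k + 1, rfl, by rw [eq_of_heq h]; rfl⟩

theorem exists_runs (A : ∀ l, net.Wt l) {l₁ l₂ : ℕ} (h : l₁ ≤ l₂) (x : net.Act l₁) :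
    ∃ y, net.Runs A l₁ x l₂ y := by
  induction l₂, h using Nat.le_induction with
  | base => exact ⟨x, .refl⟩
  | succ l₂ _ ih => exact ⟨_, .step ih.choose_spec⟩

theorem Runs.patchNorm_sub_le {A : ∀ l, net.Wt l} {L : ℕ} {a : ℕ → ℝ} {ρ : ℕ → ℕ → ℝ}
    (hA : net.Admissible L a ρ A) {l₁ l₂ : ℕ} (hl : l₂ ≤ L) {x x' : net.Act l₁}
    {y y' : net.Act l₂} (h : net.Runs A l₁ x l₂ y) (h' : net.Runs A l₁ x' l₂ y') :
    net.patchNorm l₂ (y - y') ≤ ρ l₁ l₂ * net.pixelNorm l₁ (x - x') := by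
  obtain ⟨k, rfl, h⟩ := h.exists_sub
  obtain ⟨k', hk', h'⟩ := h'.exists_sub
  obtain rfl : k = k' := by omega
  rw [eq_of_heq h, eq_of_heq h']
  exact hA.2 l₁ k hl x x'

theorem runs_F (A : ∀ l, net.Wt l) (l : ℕ) (x : net.Act 0) : net.Runs A 0 x l (net.F A l x) := by
  induction l with
  | zero => exact .refl
  | succ l ih => exact .step ih

/-- Two networks that nearly agree layer by layer along the activations of the second one nearly
agree as a whole. -/
theorem patchNorm_F_sub_F_le {L : ℕ}
    (hG : ∀ l, l < L → ∀ z z' : net.PreAct l,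
      net.pixelNorm (l + 1) (net.G l z - net.G l z') ≤ net.preNorm l (z - z'))
    {a : ℕ → ℝ} {ρ : ℕ → ℕ → ℝ} (hρ : ∀ l₁ l₂, l₁ ≤ l₂ → l₂ ≤ L → 0 < ρ l₁ l₂)
    {A A' : ∀ l, net.Wt l} (hA : net.Admissible L a ρ A) (x : net.Act 0) {e : ℕ → ℝ} {l : ℕ}
    (hl : l ≤ L)
    (he : ∀ k, k < l → net.preNorm k
      (net.conv k (A k) (net.F A' k x) - net.conv k (A' k) (net.F A' k x)) ≤ e k) :
    net.patchNorm l (net.F A l x - net.F A' l x) ≤ ∑ k ∈ Finset.range l, ρ (k + 1) l * e k := by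
  suffices h : ∀ k, k ≤ l → ∀ y, net.Runs A k (net.F A' k x) l y →
      net.patchNorm l (net.F A l x - y) ≤ ∑ k ∈ Finset.range k, ρ (k + 1) l * e k from
    h l le_rfl _ .refl
  intro k
  induction k with
  | zero =>
    intro _ y hy
    have h1 := Runs.patchNorm_sub_le hA hl (runs_F A l x) hy
    have h2 : net.pixelNorm 0 (x - net.F A' 0 x) = 0 := by simp [F, pixelNorm]
    rw [h2, mul_zero] at h1
    simpa using h1
  | succ k ih =>
    intro hk y hy
    obtain ⟨y', hy'⟩ := exists_runs A hk (net.layer k (A k) (net.F A' k x))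
    have h1 := ih (by omega) y' hy'.head
    have h2 := Runs.patchNorm_sub_le hA hl hy' hy
    have h3 : net.pixelNorm (k + 1) (net.layer k (A k) (net.F A' k x) - net.F A' (k + 1) x) ≤ e k :=
      (hG k (by omega) _ _).trans (he k hk)
    rw [Finset.sum_range_succ]
    exact (net.patchNorm_sub_le l _ y' y).trans (add_le_add h1 (h2.trans
      (mul_le_mul_of_nonneg_left h3 (hρ _ _ hk hl).le)))

theorem F_congr {A A' : ∀ l, net.Wt l} {l : ℕ} (h : ∀ k, k < l → A k = A' k) :
    net.F A l = net.F A' l := by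
  induction l with
  | zero => rfl
  | succ l ih =>
    funext x
    simp only [F]
    rw [ih fun k hk => h k (by omega), h l (by omega)]

theorem conv_eq_inner (l : ℕ) (A : net.Wt l) (x : net.Act l) (j : Fin (net.m (l + 1)))
    (o : Fin (net.O l)) :
    net.conv l A x j o = ⟪WithLp.toLp 2 (A j), net.patchVec l x o⟫_ℝ := by
  simp [conv, patchVec, PiLp.inner_apply]

/-- Covering of the convolutions of one layer, on those points whose patches are bounded. -/
theorem exists_layer_cover (net : ConvNet) (l n : ℕ) (x : Fin n → net.Act l) {a B e : ℝ}
    (ha : 0 < a) (hB : 0 < B) (he : 0 < e) :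
    ∃ C : Finset (net.Wt l),
      C.card ≤ max 1 (4 * (net.m (l + 1) * (n * net.O l))) ^ ⌊6 * (a * B / e) ^ 2⌋₊ ∧
      ∀ A, net.norm21 l A ≤ a → ∃ A' ∈ C, ∀ i, net.patchNorm l (x i) ≤ B →
        net.preNorm l (net.conv l A (x i) - net.conv l A' (x i)) ≤ e := by
  classical
  obtain ⟨C, hC, hcov⟩ := exists_sparse_cover (κ := Fin (net.m (l + 1)))
    (fun p : Fin n × Fin (net.O l) =>
      if net.patchNorm l (x p.1) ≤ B then net.patchVec l (x p.1) p.2 else 0) ha hB he (by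
    intro p
    split_ifs with h
    · exact (net.norm_patchVec_le l _ _).trans h
    · simpa using hB.le)
  refine ⟨C.image fun M => Matrix.of fun j i => M j i, ?_, fun A hA => ?_⟩
  · refine Finset.card_image_le.trans ?_
    simpa using hC
  · obtain ⟨M, hM, h⟩ := hcov (fun j => WithLp.toLp 2 (A j)) (by
      simpa [norm21, EuclideanSpace.norm_eq] using hA)
    refine ⟨_, Finset.mem_image_of_mem _ hM, fun i hi => ?_⟩
    refine Real.iSup_le (fun o => ?_) he.le
    rw [Real.sqrt_le_left he.le]
    refine le_trans (le_of_eq ?_) (h (i, o))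
    refine Finset.sum_congr rfl fun j _ => ?_
    have h2 : net.conv l (Matrix.of fun j i => M j i) (x i) j o =
        ⟪M j, net.patchVec l (x i) o⟫_ℝ := conv_eq_inner _ _ _ _ _
    rw [if_pos hi, inner_sub_left, Matrix.sub_apply, conv_eq_inner, h2]

/-- Layerwise covering of the networks. The cover of a layer depends on those of the preceding
ones, and ignores the inputs on which some preceding activation is too large. -/
theorem exists_network_cover (net : ConvNet) (L n : ℕ) (x : Fin n → net.Act 0) {a B e : ℕ → ℝ}
    (ha : ∀ l, l < L → 0 < a (l + 1)) (hB : ∀ l, l < L → 0 < B l) (he : ∀ l, l < L → 0 < e l)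
    (l : ℕ) (hl : l ≤ L) :
    ∃ C : Finset (∀ l, net.Wt l),
      C.card ≤ ∏ k ∈ Finset.range l,
        max 1 (4 * (net.m (k + 1) * (n * net.O k))) ^ ⌊6 * (a (k + 1) * B k / e k) ^ 2⌋₊ ∧
      ∀ A : ∀ l, net.Wt l, (∀ k, k < L → net.norm21 k (A k) ≤ a (k + 1)) →
        ∃ A' ∈ C, ∀ k, k < l → ∀ i, net.patchNorm k (net.F A' k (x i)) ≤ B k →
          net.preNorm k (net.conv k (A k) (net.F A' k (x i)) -
            net.conv k (A' k) (net.F A' k (x i))) ≤ e k := by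
  classical
  induction l with
  | zero => exact ⟨{fun _ => 0}, by simp, fun A _ => ⟨_, Finset.mem_singleton_self _, by simp⟩⟩
  | succ l ih =>
    obtain ⟨C, hC, hcov⟩ := ih (by omega)
    choose D hD hDcov using fun A' : ∀ l, net.Wt l => exists_layer_cover net l n
      (fun i => net.F A' l (x i)) (ha l hl) (hB l hl) (he l hl)
    refine ⟨C.biUnion fun A' => (D A').image fun M => Function.update A' l M, ?_, fun A hA => ?_⟩
    · rw [Finset.prod_range_succ]
      refine (Finset.card_biUnion_le_card_mul _ _ _ fun A' _ =>
        Finset.card_image_le.trans (hD A')).trans (Nat.mul_le_mul_right _ hC)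
    · obtain ⟨A', hA', h⟩ := hcov A hA
      obtain ⟨M, hM, h'⟩ := hDcov A' (A l) (hA l hl)
      refine ⟨Function.update A' l M, Finset.mem_biUnion.2
        ⟨A', hA', Finset.mem_image_of_mem _ hM⟩, fun k hk i => ?_⟩
      have hF : net.F (Function.update A' l M) k = net.F A' k :=
        F_congr fun k' hk' => Function.update_of_ne (by omega) _ _
      rw [hF]
      rcases Nat.lt_succ_iff_lt_or_eq.1 hk with hk | rfl
      · rw [Function.update_of_ne (by omega)]
        exact h k hk i
      · rw [Function.update_self]
        exact h' i

end ConvNet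

namespace ConvNet

variable {net : ConvNet} {L : ℕ} {hw : net.w L = 1} {b : ℕ → ℝ}

theorem loss_nonneg (hb : ∀ l, l ≤ L → 0 < b l) (A : ∀ l, net.Wt l) (x : net.Act 0)
    (y : Fin (net.U L)) : 0 ≤ net.loss L hw b A x y :=
  le_max_of_le_right (ramp_nonneg (hb L le_rfl) _)

theorem loss_le_one (hb : ∀ l, l ≤ L → 0 < b l) (A : ∀ l, net.Wt l) (x : net.Act 0)
    (y : Fin (net.U L)) : net.loss L hw b A x y ≤ 1 :=
  max_le (Real.iSup_le (fun l => ramp_le_one (hb l l.2.2.le) _) zero_le_one)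
    (ramp_le_one (hb L le_rfl) _)

theorem loss_eq_one (hb : ∀ l, l ≤ L → 0 < b l) {A : ∀ l, net.Wt l} {x : net.Act 0}
    {y : Fin (net.U L)} {l : ℕ} (h1 : 1 ≤ l) (hl : l < L)
    (h : 2 * b l ≤ net.patchNorm l (net.F A l x)) : net.loss L hw b A x y = 1 := by
  refine le_antisymm (loss_le_one hb A x y) (le_max_of_le_left ?_)
  have := le_ciSup (Finite.bddAbove_range fun l : Set.Ico 1 L =>
    ramp (b l) (net.patchNorm l (net.F A l x) - 2 * b l)) ⟨l, h1, hl⟩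
  rwa [ramp_of_nonneg (by linarith)] at this

theorem abs_loss_sub_loss_le (hb : ∀ l, l ≤ L → 0 < b l)
    (hout : ∀ p : Fin (net.U L) × Fin (net.w L), ∃ o i, net.patch L o i = p)
    {A A' : ∀ l, net.Wt l} {x : net.Act 0} (y : Fin (net.U L)) {c : ℝ} (hc : 0 ≤ c)
    (h : ∀ l, l ≤ L → net.patchNorm l (net.F A l x - net.F A' l x) ≤ c * b l) :
    |net.loss L hw b A x y - net.loss L hw b A' x y| ≤ 2 * c := by
  refine (abs_max_sub_max_le_max _ _ _ _).trans (max_le ?_ ?_)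
  · refine abs_iSup_sub_iSup_le (by positivity) fun l => ?_
    refine (abs_ramp_sub_le (hb l l.2.2.le) ?_).trans (by linarith : c ≤ 2 * c)
    rw [sub_sub_sub_cancel_right]
    exact (net.abs_patchNorm_sub_patchNorm_le _ _ _).trans (h l l.2.2.le)
  · have hscore : ∀ j, |net.score L hw A x j - net.score L hw A' x j| ≤ c * b L := fun j =>
      (net.abs_apply_le_patchNorm (net.F A L x - net.F A' L x) (j, ⟨0, by omega⟩)
        (hout _)).trans (h L le_rfl)
    refine abs_ramp_sub_le (hb L le_rfl) ?_
    rw [sub_sub_sub_comm]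
    refine (abs_sub _ _).trans ?_
    have h1 : |(⨆ j : {j : Fin (net.U L) // j ≠ y}, net.score L hw A x j) -
        ⨆ j : {j : Fin (net.U L) // j ≠ y}, net.score L hw A' x j| ≤ c * b L :=
      abs_iSup_sub_iSup_le (mul_nonneg hc (hb L le_rfl).le) fun j => hscore j
    linarith [hscore y]

open Classical in
/-- The loss of the network `A'`, replaced by `1` on inputs for which the activations of some layer
leave the range that `A'` has to reproduce. -/
noncomputable def truncLoss (net : ConvNet) (L : ℕ) (hw : net.w L = 1) (b : ℕ → ℝ)
    (A' : ∀ l, net.Wt l) (x : net.Act 0) (y : Fin (net.U L)) : ℝ :=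
  if ∀ l, l < L → net.patchNorm l (net.F A' l x) ≤ 3 * b l then net.loss L hw b A' x y else 1

theorem abs_loss_sub_truncLoss_le (hb : ∀ l, l ≤ L → 0 < b l)
    (hout : ∀ p : Fin (net.U L) × Fin (net.w L), ∃ o i, net.patch L o i = p)
    (hG : ∀ l, l < L → ∀ z z' : net.PreAct l,
      net.pixelNorm (l + 1) (net.G l z - net.G l z') ≤ net.preNorm l (z - z'))
    {a : ℕ → ℝ} {ρ : ℕ → ℕ → ℝ} (hρ : ∀ l₁ l₂, l₁ ≤ l₂ → l₂ ≤ L → 0 < ρ l₁ l₂)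
    {A A' : ∀ l, net.Wt l} (hA : net.Admissible L a ρ A) {x : net.Act 0}
    (hx : net.patchNorm 0 x ≤ b 0) (y : Fin (net.U L)) {e : ℕ → ℝ} {c : ℝ} (hc : 0 ≤ c)
    (hc1 : c ≤ 1) (hec : ∀ l, l ≤ L → ∑ k ∈ Finset.range l, ρ (k + 1) l * e k ≤ c * b l)
    (he : ∀ k, k < L → net.patchNorm k (net.F A' k x) ≤ 3 * b k → net.preNorm k
      (net.conv k (A k) (net.F A' k x) - net.conv k (A' k) (net.F A' k x)) ≤ e k) :
    |net.loss L hw b A x y - net.truncLoss L hw b A' x y| ≤ 2 * c := by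
  have hclose : ∀ l, l ≤ L → (∀ k, k < l → net.patchNorm k (net.F A' k x) ≤ 3 * b k) →
      net.patchNorm l (net.F A l x - net.F A' l x) ≤ c * b l := fun l hl h =>
    (patchNorm_F_sub_F_le hG hρ hA x hl fun k hk => he k (by omega) (h k hk)).trans (hec l hl)
  unfold truncLoss
  split_ifs with h
  · exact abs_loss_sub_loss_le hb hout y hc fun l hl => hclose l hl fun k hk => h k (by omega)
  · push Not at h
    classical
    obtain ⟨hl, hgt⟩ := Nat.find_spec h
    have hmin : ∀ k, k < Nat.find h → net.patchNorm k (net.F A' k x) ≤ 3 * b k := fun k hk =>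
      not_lt.1 fun hlt => Nat.find_min h hk ⟨by omega, hlt⟩
    have hd := hclose _ hl.le hmin
    have hb' := hb _ hl.le
    have h1 : 1 ≤ Nat.find h := by
      by_contra h0
      have h0 : Nat.find h = 0 := by omega
      rw [h0] at hgt
      have : net.F A' 0 x = x := rfl
      rw [this] at hgt
      linarith [hb 0 (Nat.zero_le L)]
    rw [loss_eq_one hb h1 hl, sub_self, abs_zero]
    · positivity
    · have h2 := (abs_sub_le_iff.1 (net.abs_patchNorm_sub_patchNorm_le _
        (net.F A (Nat.find h) x) (net.F A' (Nat.find h) x))).2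
      have h3 : c * b (Nat.find h) ≤ 1 * b (Nat.find h) :=
        mul_le_mul_of_nonneg_right hc1 hb'.le
      linarith

/-- External cover of the loss class, for any distribution of the precision to the layers. -/
theorem coveringNumber_lossClass_le {n : ℕ} (hb : ∀ l, l ≤ L → 0 < b l)
    (hout : ∀ p : Fin (net.U L) × Fin (net.w L), ∃ o i, net.patch L o i = p)
    (hG : ∀ l, l < L → ∀ z z' : net.PreAct l,
      net.pixelNorm (l + 1) (net.G l z - net.G l z') ≤ net.preNorm l (z - z'))
    {a : ℕ → ℝ} (ha : ∀ l, l < L → 0 < a (l + 1))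
    {ρ : ℕ → ℕ → ℝ} (hρ : ∀ l₁ l₂, l₁ ≤ l₂ → l₂ ≤ L → 0 < ρ l₁ l₂)
    (s : Fin n → net.Act 0 × Fin (net.U L)) (hs : ∀ i, net.patchNorm 0 (s i).1 ≤ b 0)
    {e : ℕ → ℝ} (he : ∀ l, l < L → 0 < e l) {ε : ℝ} (hε : 0 < ε) (hε1 : ε ≤ 4)
    (hec : ∀ l, l ≤ L → ∑ k ∈ Finset.range l, ρ (k + 1) l * e k ≤ ε / 4 * b l) :
    Metric.coveringNumber ε.toNNReal (net.lossClass L hw a b ρ s) ≤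
      ((∏ k ∈ Finset.range L, max 1 (4 * (net.m (k + 1) * (n * net.O k))) ^
        ⌊6 * (a (k + 1) * (3 * b k) / e k) ^ 2⌋₊ : ℕ) : ℕ∞) := by
  classical
  obtain ⟨C, hC, hcov⟩ := exists_network_cover net L n (fun i => (s i).1) (a := a)
    (B := fun k => 3 * b k) (e := e) ha (fun l hl => by have := hb l hl.le; positivity) he L le_rfl
  set D : Finset (Fin n → ℝ) :=
    C.image fun A' i => net.truncLoss L hw b A' (s i).1 (s i).2 with hD
  have hcover : Metric.IsCover (ε / 2).toNNReal (net.lossClass L hw a b ρ s) (D : Set _) := by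
    rintro v ⟨A, hA, rfl⟩
    obtain ⟨A', hA', h⟩ := hcov A hA.1
    refine ⟨_, Finset.mem_coe.2 (Finset.mem_image_of_mem _ hA'), ?_⟩
    change edist _ _ ≤ _
    rw [edist_dist]
    refine ENNReal.ofReal_le_ofReal ((dist_pi_le_iff (by positivity)).2 fun i => ?_)
    rw [Real.dist_eq]
    refine (abs_loss_sub_truncLoss_le hb hout hG hρ hA (hs i) _ (by positivity : 0 ≤ ε / 4)
      (by linarith) hec fun k hk hk' => h k hk i hk').trans (by linarith)
  have h2 : ε.toNNReal = 2 * (ε / 2).toNNReal := by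
    rw [← Real.toNNReal_ofNat 2, ← Real.toNNReal_mul zero_le_two]
    congr 1
    ring
  rw [h2]
  refine (Metric.coveringNumber_two_mul_le_externalCoveringNumber _ _).trans
    (hcover.externalCoveringNumber_le_encard.trans ?_)
  rw [Set.encard_coe_eq_coe_finsetCard]
  exact_mod_cast Finset.card_image_le.trans hC

theorem coveringNumber_lossClass_le_one {n : ℕ} (hb : ∀ l, l ≤ L → 0 < b l) {a : ℕ → ℝ}
    {ρ : ℕ → ℕ → ℝ} (s : Fin n → net.Act 0 × Fin (net.U L)) {ε : ℝ} (hε : 1 ≤ ε) :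
    Metric.coveringNumber ε.toNNReal (net.lossClass L hw a b ρ s) ≤ 1 := by
  refine Metric.coveringNumber_le_one_of_ediam_le (Metric.ediam_le ?_)
  rintro _ ⟨A, _, rfl⟩ _ ⟨A', _, rfl⟩
  rw [edist_dist]
  refine ENNReal.ofReal_le_ofReal ((dist_pi_le_iff (by linarith)).2 fun i => ?_)
  rw [Real.dist_eq, abs_sub_le_iff]
  constructor <;>
  linarith [loss_nonneg (hw := hw) hb A (s i).1 (s i).2, loss_le_one (hw := hw) hb A (s i).1 (s i).2,
    loss_nonneg (hw := hw) hb A' (s i).1 (s i).2, loss_le_one (hw := hw) hb A' (s i).1 (s i).2]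

/-- Either the network has no weights that matter and the logarithm is read as `0`, or its
argument dominates `7 n` times each layer width. -/
theorem maxWidth_dichotomy (net : ConvNet) {L n : ℕ} {a : ℕ → ℝ} {ρ : ℕ → ℕ → ℝ}
    {b : ℕ → ℝ} (hΓ : ∀ l : Fin L, 0 ≤ b l * a (l + 1) * rhoPlus L ρ b (l + 1))
    {ε : ℝ} (hε : 0 < ε) :
    ((∀ l, l < L → net.O l * net.m (l + 1) = 0) ∧
      32 * net.Gam L a b ρ * n / ε + 7 * net.maxWidth L * n = 0) ∨
    (1 ≤ net.maxWidth L ∧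
      7 * net.maxWidth L * n ≤ 32 * net.Gam L a b ρ * n / ε + 7 * net.maxWidth L * n) := by
  by_cases h : ∀ l, l < L → net.O l * net.m (l + 1) = 0
  · refine Or.inl ⟨h, ?_⟩
    have h' : ∀ l : Fin L, (net.O l : ℝ) * net.m (l + 1) = 0 := fun l => by
      exact_mod_cast h l l.2
    have h1 : net.maxWidth L = 0 := by simp [maxWidth, h']
    have h2 : net.Gam L a b ρ = 0 := by
      have : ∀ l : Fin L,
          b l * a (l + 1) * net.O l * net.m (l + 1) * rhoPlus L ρ b (l + 1) = 0 := fun l => by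
        rw [mul_assoc (b l * a (l + 1)), h' l, mul_zero, zero_mul]
      simp [Gam, this]
    simp [h1, h2]
  · push Not at h
    obtain ⟨l, hl, h⟩ := h
    refine Or.inr ⟨?_, ?_⟩
    · have h1 : (1 : ℝ) ≤ (net.O l : ℝ) * net.m (l + 1) := by
        exact_mod_cast Nat.one_le_iff_ne_zero.2 h
      exact h1.trans (le_ciSup (Finite.bddAbove_range fun l : Fin L =>
        (net.O l : ℝ) * net.m (l + 1)) ⟨l, hl⟩)
    · have : 0 ≤ net.Gam L a b ρ := Real.iSup_nonneg fun l => by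
        have h2 : b l * a (l + 1) * net.O l * net.m (l + 1) * rhoPlus L ρ b (l + 1) =
          b l * a (l + 1) * rhoPlus L ρ b (l + 1) * (net.O l * net.m (l + 1)) := by ring
        rw [h2]
        exact mul_nonneg (hΓ l) (by positivity)
      have : 0 ≤ 32 * net.Gam L a b ρ * n / ε := by positivity
      linarith

end ConvNet

theorem le_rhoPlus {L : ℕ} {ρ : ℕ → ℕ → ℝ} {b : ℕ → ℝ} {l i : ℕ} (hl : l ≤ i) (hi : i ≤ L) :
    ρ l i / b i ≤ rhoPlus L ρ b l :=
  le_ciSup (Finite.bddAbove_range fun i : Set.Icc l L => ρ l i / b i) ⟨i, hl, hi⟩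

theorem complexityR_sq (L : ℕ) (a b : ℕ → ℝ) (ρ : ℕ → ℕ → ℝ)
    (h : ∀ l ∈ Finset.range L, 0 ≤ a (l + 1) * b l * rhoPlus L ρ b (l + 1)) :
    complexityR L a b ρ ^ 2 = (∑ l ∈ Finset.range L,
      (a (l + 1) * b l * rhoPlus L ρ b (l + 1)) ^ ((2 : ℝ) / 3)) ^ 3 := by
  rw [complexityR, ← Real.rpow_natCast, ← Real.rpow_natCast, ← Real.rpow_mul]
  · norm_num
  · exact Finset.sum_nonneg fun l hl => Real.rpow_nonneg (h l hl) _

/-- Covering number bound for the loss class. `hG`: the nonlinearities are `1`-Lipschitz for the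
positionwise Euclidean sup norms. `hout`: every score belongs to a patch of the output layer.
The margin `γ` is `b L`. The covering number is the one with centres in the class; it bounds the one with free centres. -/
theorem loss_class_covering_bound
    (net : ConvNet) (L n : ℕ) (hL : 0 < L) (hn : 0 < n)
    (hw : net.w L = 1) (hK : 2 ≤ net.U L)
    (hout : ∀ p : Fin (net.U L) × Fin (net.w L), ∃ o i, net.patch L o i = p)
    (hG : ∀ l, l < L → ∀ z z' : net.PreAct l,
      net.pixelNorm (l + 1) (net.G l z - net.G l z') ≤ net.preNorm l (z - z'))
    (a b : ℕ → ℝ)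
    (ha : ∀ l, 1 ≤ l → l ≤ L → 0 < a l) (hb : ∀ l, l ≤ L → 0 < b l)
    (ρ : ℕ → ℕ → ℝ) (hρ : ∀ l₁ l₂, l₁ ≤ l₂ → l₂ ≤ L → 0 < ρ l₁ l₂)
    (s : Fin n → net.Act 0 × Fin (net.U L))
    (hs : ∀ i, net.patchNorm 0 (s i).1 ≤ b 0)
    (ε : ℝ) (hε : 0 < ε) :
    Metric.coveringNumber ε.toNNReal (net.lossClass L hw a b ρ s) ≠ ⊤ ∧
      Real.log ((Metric.coveringNumber ε.toNNReal (net.lossClass L hw a b ρ s)).toNat : ℝ) ≤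
        2 ^ 12 * (complexityR L a b ρ ^ 2 / ε ^ 2) *
          Real.logb 2 (32 * net.Gam L a b ρ * n / ε + 7 * net.maxWidth L * n) := by
  have ha' : ∀ l, l < L → 0 < a (l + 1) := fun l hl => ha _ (by omega) hl
  have hplus : ∀ l, l < L → 0 < rhoPlus L ρ b (l + 1) := fun l hl =>
    (div_pos (hρ (l + 1) L hl le_rfl) (hb L le_rfl)).trans_le (le_rhoPlus hl le_rfl)
  set r : ℕ → ℝ := fun l => a (l + 1) * b l * rhoPlus L ρ b (l + 1) with hr
  have hr0 : ∀ l, l < L → 0 < r l := fun l hl =>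
    mul_pos (mul_pos (ha' l hl) (hb l hl.le)) (hplus l hl)
  set S : ℝ := ∑ l ∈ Finset.range L, r l ^ ((2 : ℝ) / 3) with hS
  have hR : complexityR L a b ρ ^ 2 = S ^ 3 :=
    complexityR_sq L a b ρ fun l hl => (hr0 l (Finset.mem_range.1 hl)).le
  have hterm : ∀ l, l < L → 0 < r l ^ ((2 : ℝ) / 3) := fun l hl => Real.rpow_pos_of_pos (hr0 l hl) _
  have hS0 : 0 < S := Finset.sum_pos (fun l hl => hterm l (Finset.mem_range.1 hl))
    (Finset.nonempty_range_iff.2 hL.ne')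
  set V : ℝ := 32 * net.Gam L a b ρ * n / ε + 7 * net.maxWidth L * n with hV
  have hdich := net.maxWidth_dichotomy (L := L) (a := a) (ρ := ρ) (n := n) (b := b) (fun l => by
    have h1 := hb l l.2.le
    have h2 := ha' l l.2
    have h3 := hplus l l.2
    positivity) hε
  have hn1 : (1 : ℝ) ≤ n := by exact_mod_cast hn
  have hlogV : 0 ≤ Real.logb 2 V := by
    rcases hdich with ⟨_, h0⟩ | ⟨h1, h2⟩
    · rw [hV, h0, Real.logb_zero]
    · refine Real.logb_nonneg one_lt_two (le_trans ?_ h2)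
      nlinarith
  have hrhs : 0 ≤ 2 ^ 12 * (complexityR L a b ρ ^ 2 / ε ^ 2) * Real.logb 2 V := by positivity
  rcases le_total 1 ε with hε1 | hε1
  · have h1 := ConvNet.coveringNumber_lossClass_le_one (hw := hw) (a := a) (ρ := ρ) hb s hε1
    refine ⟨ne_top_of_le_ne_top (by simp) h1, le_trans ?_ hrhs⟩
    have h2 := ENat.toNat_le_of_le_natCast (n := 1) (by exact_mod_cast h1)
    exact Real.log_nonpos (Nat.cast_nonneg _) (by exact_mod_cast h2)
  set e : ℕ → ℝ := fun l => ε / 4 * (r l ^ ((2 : ℝ) / 3) / S) / rhoPlus L ρ b (l + 1) with he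
  have he0 : ∀ l, l < L → 0 < e l := fun l hl => by
    have h1 := hterm l hl
    have h2 := hplus l hl
    positivity
  have hec : ∀ l, l ≤ L → ∑ k ∈ Finset.range l, ρ (k + 1) l * e k ≤ ε / 4 * b l := by
    intro l hl
    have hbl := hb l hl
    calc ∑ k ∈ Finset.range l, ρ (k + 1) l * e k
        ≤ ∑ k ∈ Finset.range l, ε / 4 * b l / S * r k ^ ((2 : ℝ) / 3) := by
          refine Finset.sum_le_sum fun k hk => ?_
          have hk := Finset.mem_range.1 hk
          have h1 := he0 k (by omega)
          have h2 := hplus k (by omega)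
          calc ρ (k + 1) l * e k ≤ b l * rhoPlus L ρ b (k + 1) * e k := by
                gcongr
                rw [mul_comm, ← div_le_iff₀ hbl]
                exact le_rhoPlus hk hl
            _ = ε / 4 * b l / S * r k ^ ((2 : ℝ) / 3) := by
                rw [he]
                field_simp
      _ = ε / 4 * b l / S * ∑ k ∈ Finset.range l, r k ^ ((2 : ℝ) / 3) := by rw [Finset.mul_sum]
      _ ≤ ε / 4 * b l / S * S := by
          gcongr
          exact Finset.sum_le_sum_of_subset_of_nonneg (Finset.range_mono hl)
            fun k hk _ => (hterm k (Finset.mem_range.1 hk)).le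
      _ = ε / 4 * b l := by field_simp
  have hcov := ConvNet.coveringNumber_lossClass_le (hw := hw) hb hout hG ha' hρ s hs he0 hε
    (by linarith) hec
  refine ⟨ne_top_of_le_ne_top (ENat.natCast_ne_top _) hcov, ?_⟩
  have hN := ENat.toNat_le_of_le_natCast hcov
  set N := (Metric.coveringNumber ε.toNNReal (net.lossClass L hw a b ρ s)).toNat with hNdef
  rcases Nat.eq_zero_or_pos N with hN0 | hN0
  · rw [hN0]
    simpa using hrhs
  set K : ℕ → ℕ := fun k => ⌊6 * (a (k + 1) * (3 * b k) / e k) ^ 2⌋₊ with hKdef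
  have hsteps : ∀ k, k < L → (K k : ℝ) ≤ 864 * S ^ 2 / ε ^ 2 * r k ^ ((2 : ℝ) / 3) := by
    intro k hk
    refine (Nat.floor_le (by positivity)).trans (le_of_eq ?_)
    have h1 := hr0 k hk
    have h2 := hterm k hk
    have h3 := hplus k hk
    have h4 : r k ^ 2 = (r k ^ ((2 : ℝ) / 3)) ^ 3 := by
      rw [← Real.rpow_natCast, ← Real.rpow_natCast, ← Real.rpow_mul h1.le]
      norm_num
    have h5 : a (k + 1) * (3 * b k) / e k = 12 * r k * S / (ε * r k ^ ((2 : ℝ) / 3)) := by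
      rw [he]
      simp only [hr]
      field_simp
      ring
    rw [h5, div_pow, mul_pow, mul_pow, h4]
    field_simp
    ring
  have hlogN : Real.log N ≤ ∑ k ∈ Finset.range L,
      (K k : ℝ) * Real.log (max 1 (4 * (net.m (k + 1) * (n * net.O k))) : ℕ) := by
    have h1 : (N : ℝ) ≤ ∏ k ∈ Finset.range L,
        ((max 1 (4 * (net.m (k + 1) * (n * net.O k))) : ℕ) : ℝ) ^ K k := by
      exact_mod_cast hN
    refine (Real.log_le_log (by exact_mod_cast hN0) h1).trans (le_of_eq ?_)
    rw [Real.log_prod]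
    · exact Finset.sum_congr rfl fun k _ => Real.log_pow _ _
    · intro k _
      have : max 1 (4 * (net.m (k + 1) * (n * net.O k))) ≠ 0 := by positivity
      exact pow_ne_zero _ (by exact_mod_cast this)
  have hlog : ∀ k, k < L →
      Real.log (max 1 (4 * (net.m (k + 1) * (n * net.O k))) : ℕ) ≤ Real.logb 2 V := by
    intro k hk
    rcases hdich with ⟨h0, _⟩ | ⟨h1, h2⟩
    · have : net.m (k + 1) * (n * net.O k) = n * (net.O k * net.m (k + 1)) := by ring
      rw [this, h0 k hk]
      simpa using hlogV
    · have hWk : (net.O k : ℝ) * net.m (k + 1) ≤ net.maxWidth L :=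
        le_ciSup (Finite.bddAbove_range fun l : Fin L => (net.O l : ℝ) * net.m (l + 1)) ⟨k, hk⟩
      have hle : ((max 1 (4 * (net.m (k + 1) * (n * net.O k))) : ℕ) : ℝ) ≤ V := by
        push_cast
        refine max_le (le_trans ?_ h2) (le_trans ?_ h2)
        · nlinarith
        · have := mul_le_mul_of_nonneg_right hWk (Nat.cast_nonneg (α := ℝ) n)
          nlinarith
      have h1' : (1 : ℝ) ≤ (max 1 (4 * (net.m (k + 1) * (n * net.O k))) : ℕ) := by
        exact_mod_cast le_max_left _ _
      refine (Real.log_le_log (by linarith) hle).trans ?_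
      rw [Real.logb, le_div_iff₀ (Real.log_pos one_lt_two)]
      have hl0 : 0 ≤ Real.log V := Real.log_nonneg (by linarith)
      have hl2 : Real.log 2 ≤ 1 := by linarith [Real.log_two_lt_d9]
      exact mul_le_of_le_one_right hl0 hl2
  calc Real.log N ≤ ∑ k ∈ Finset.range L,
        (K k : ℝ) * Real.log (max 1 (4 * (net.m (k + 1) * (n * net.O k))) : ℕ) := hlogN
    _ ≤ ∑ k ∈ Finset.range L,
        864 * S ^ 2 / ε ^ 2 * r k ^ ((2 : ℝ) / 3) * Real.logb 2 V := by
        refine Finset.sum_le_sum fun k hk => ?_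
        have hk := Finset.mem_range.1 hk
        have := hterm k hk
        calc _ ≤ (K k : ℝ) * Real.logb 2 V :=
              mul_le_mul_of_nonneg_left (hlog k hk) (Nat.cast_nonneg _)
          _ ≤ _ := mul_le_mul_of_nonneg_right (hsteps k hk) hlogV
    _ = 864 * (complexityR L a b ρ ^ 2 / ε ^ 2) * Real.logb 2 V := by
        rw [← Finset.sum_mul, ← Finset.mul_sum, hR, ← hS]
        ring
    _ ≤ 2 ^ 12 * (complexityR L a b ρ ^ 2 / ε ^ 2) * Real.logb 2 V := by
        gcongr
        norm_num
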